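/- arXiv:1010.4859 — 2 statements merged into one kernel-verified Lean document; each statement's English description precedes it below -/
import Mathlib

section
/- Let R, L > 0, k, l ∈ ℕ₀, ξ ∈ ℝ, and ρ ≥ 0 with (lπ/R)² + ρ² > 0. Then √(2/π) ∫_0^L ∫_0^R cos(xξ)·r·J₀(rρ)·cos(kπ√(L²−x²)/L)·cos(lπ√(R²−r²)/R) / (√(L²−x²)·√(R²−r²)) dr dx = √(π/2)·J₀(L√((kπ/L)²+ξ²)) · sin(R√((lπ/R)²+ρ²))/√((lπ/R)²+ρ²). (This computes the combined Fourier–Hankel transform ĝ(ξ,ρ) of the orthogonal function g = i_even^{k,l}, evenly extended in x.) -/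
open MeasureTheory Metric Real Filter

noncomputable section

/-- The Bessel function of order zero, `J₀(z) = Σ_{k=0}^∞ (-1)^k z^{2k} / (2^{2k} (k!)²)`. -/
def J0 (z : ℝ) : ℝ :=
  ∑' k : ℕ, (-1 : ℝ) ^ k * z ^ (2 * k) / (2 ^ (2 * k) * ((Nat.factorial k : ℝ)) ^ 2)

/-- The binomial theorem, divided by `N!`. -/
lemma sum_antidiagonal_pow_div_factorial (a b : ℝ) (N : ℕ) :
    ∑ p ∈ Finset.HasAntidiagonal.antidiagonal N,
      (a ^ p.1 / (Nat.factorial p.1 : ℝ)) * (b ^ p.2 / (Nat.factorial p.2 : ℝ)) =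
      (a + b) ^ N / (Nat.factorial N : ℝ) := by
  rw [(Commute.all a b).add_pow', Finset.sum_div]
  refine Finset.sum_congr rfl fun p hp => ?_
  obtain rfl := Finset.HasAntidiagonal.mem_antidiagonal.mp hp
  have h : ((Nat.choose (p.1 + p.2) p.1 : ℕ) : ℝ) * (Nat.factorial p.1 : ℝ) *
      (Nat.factorial p.2 : ℝ) = (Nat.factorial (p.1 + p.2) : ℝ) := by
    rw [Nat.choose_symm_add]
    exact_mod_cast Nat.add_choose_mul_factorial_mul_factorial p.1 p.2
  rw [nsmul_eq_mul, ← h]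
  have h1 : (Nat.factorial p.1 : ℝ) ≠ 0 := by positivity
  have h2 : (Nat.factorial p.2 : ℝ) ≠ 0 := by positivity
  have h3 : ((Nat.choose (p.1 + p.2) p.1 : ℕ) : ℝ) ≠ 0 := by
    exact_mod_cast (Nat.choose_pos (Nat.le_add_right _ _)).ne'
  field_simp

/-- Termwise integration of a Cauchy product of two power series of exponential type in
`sin ^ 2` and `cos ^ 2`, against a bounded continuous weight. -/
lemma hasSum_integral_mul_tsum_sin_sq_mul_tsum_cos_sq {α β : ℕ → ℝ} {A B : ℝ} {w : ℝ → ℝ}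
    (hw : Continuous w) (hw1 : ∀ t, |w t| ≤ 1)
    (hα : ∀ n, |α n| ≤ A ^ n / (Nat.factorial n : ℝ))
    (hβ : ∀ n, |β n| ≤ B ^ n / (Nat.factorial n : ℝ)) (a b : ℝ) :
    HasSum (fun N => ∑ p ∈ Finset.HasAntidiagonal.antidiagonal N,
        α p.1 * β p.2 * ∫ t in a..b, w t * sin t ^ (2 * p.1) * cos t ^ (2 * p.2))
      (∫ t in a..b, w t * (∑' n, α n * sin t ^ (2 * n)) * ∑' n, β n * cos t ^ (2 * n)) := by
  have hs : ∀ (n : ℕ) (t : ℝ), |α n * sin t ^ (2 * n)| ≤ A ^ n / (Nat.factorial n : ℝ) := by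
    intro n t
    rw [abs_mul, abs_pow]
    exact (mul_le_of_le_one_right (abs_nonneg _)
      (pow_le_one₀ (abs_nonneg _) (abs_sin_le_one t))).trans (hα n)
  have hc : ∀ (n : ℕ) (t : ℝ), |β n * cos t ^ (2 * n)| ≤ B ^ n / (Nat.factorial n : ℝ) := by
    intro n t
    rw [abs_mul, abs_pow]
    exact (mul_le_of_le_one_right (abs_nonneg _)
      (pow_le_one₀ (abs_nonneg _) (abs_cos_le_one t))).trans (hβ n)
  have key := intervalIntegral.hasSum_integral_of_dominated_convergence (μ := volume)
    (a := a) (b := b)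
    (F := fun N t => ∑ p ∈ Finset.HasAntidiagonal.antidiagonal N,
      w t * ((α p.1 * sin t ^ (2 * p.1)) * (β p.2 * cos t ^ (2 * p.2))))
    (f := fun t => w t * (∑' n, α n * sin t ^ (2 * n)) * ∑' n, β n * cos t ^ (2 * n))
    (fun N _ => (A + B) ^ N / (Nat.factorial N : ℝ))
    (fun N => Continuous.aestronglyMeasurable (by fun_prop)) ?_ ?_ ?_ ?_
  · refine (congrArg (HasSum · _) (funext fun N => ?_)).mp key
    rw [intervalIntegral.integral_finsetSum
      (fun p _ => Continuous.intervalIntegrable (by fun_prop) _ _)]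
    refine Finset.sum_congr rfl fun p _ => ?_
    rw [← intervalIntegral.integral_const_mul]
    congr 1 with t
    ring
  · refine fun N => Eventually.of_forall fun t _ => ?_
    rw [← sum_antidiagonal_pow_div_factorial]
    refine (norm_sum_le _ _).trans (Finset.sum_le_sum fun p _ => ?_)
    rw [Real.norm_eq_abs, abs_mul, abs_mul (α p.1 * _)]
    refine (mul_le_of_le_one_left (by positivity) (hw1 t)).trans ?_
    exact mul_le_mul (hs _ _) (hc _ _) (abs_nonneg _) ((abs_nonneg _).trans (hs p.1 t))
  · exact Eventually.of_forall fun t _ => Real.summable_pow_div_factorial _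
  · exact intervalIntegrable_const
  · refine Eventually.of_forall fun t _ => ?_
    have h1 : Summable fun n => ‖α n * sin t ^ (2 * n)‖ :=
      Summable.of_nonneg_of_le (fun _ => norm_nonneg _) (fun n => hs n t)
        (Real.summable_pow_div_factorial A)
    have h2 : Summable fun n => ‖β n * cos t ^ (2 * n)‖ :=
      Summable.of_nonneg_of_le (fun _ => norm_nonneg _) (fun n => hc n t)
        (Real.summable_pow_div_factorial B)
    simp only [← Finset.mul_sum]
    rw [mul_assoc, tsum_mul_tsum_eq_tsum_sum_antidiagonal_of_summable_norm h1 h2]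
    exact ((summable_norm_sum_mul_antidiagonal_of_summable_norm h1 h2).of_norm.hasSum).mul_left _

/-- Raising the power of `sin ^ 2` by one in a weighted trigonometric moment. -/
lemma integral_mul_sin_pow_succ_mul_cos_pow {w : ℝ → ℝ} (hw : Continuous w) (a b : ℝ) (m n : ℕ) :
    ∫ t in a..b, w t * sin t ^ (2 * (m + 1)) * cos t ^ (2 * n) =
      (∫ t in a..b, w t * sin t ^ (2 * m) * cos t ^ (2 * n)) -
        ∫ t in a..b, w t * sin t ^ (2 * m) * cos t ^ (2 * (n + 1)) := by
  rw [← intervalIntegral.integral_sub (Continuous.intervalIntegrable (by fun_prop) _ _)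
    (Continuous.intervalIntegrable (by fun_prop) _ _)]
  congr 1 with t
  have h : sin t ^ (2 * (m + 1)) = sin t ^ (2 * m) * (1 - cos t ^ 2) := by
    rw [← sin_sq]; ring
  rw [h]
  ring

lemma integral_cos_pow_even (n : ℕ) :
    ∫ t in (0 : ℝ)..π / 2, cos t ^ (2 * n) =
      π / 2 * (Nat.factorial (2 * n) : ℝ) / (4 ^ n * (Nat.factorial n : ℝ) ^ 2) := by
  rw [EulerSine.integral_cos_pow_eq, integral_sin_pow_even]
  induction n with
  | zero => simp; ring
  | succ n ih =>
    rw [Finset.prod_range_succ, ← mul_assoc π, ← mul_assoc, ih,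
      show 2 * (n + 1) = 2 * n + 1 + 1 by ring]
    simp only [Nat.factorial_succ]
    push_cast
    have h : (Nat.factorial n : ℝ) ≠ 0 := by positivity
    field_simp
    ring

lemma integral_sin_pow_even_mul_cos_pow_even_zero_pi_div_two (m n : ℕ) :
    ∫ t in (0 : ℝ)..π / 2, 1 * sin t ^ (2 * m) * cos t ^ (2 * n) =
      π / 2 * (Nat.factorial (2 * m) : ℝ) * (Nat.factorial (2 * n) : ℝ) /
        (4 ^ (m + n) * (Nat.factorial m : ℝ) * (Nat.factorial n : ℝ) *
          (Nat.factorial (m + n) : ℝ)) := by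
  induction m generalizing n with
  | zero =>
    simp only [Nat.mul_zero, pow_zero, one_mul, integral_cos_pow_even, Nat.zero_add,
      Nat.factorial_zero, Nat.cast_one, mul_one]
    ring
  | succ m ih =>
    rw [integral_mul_sin_pow_succ_mul_cos_pow continuous_const, ih, ih,
      show 2 * (n + 1) = 2 * n + 1 + 1 by ring, show 2 * (m + 1) = 2 * m + 1 + 1 by ring,
      show m + 1 + n = m + n + 1 by ring, show m + (n + 1) = m + n + 1 by ring]
    simp only [Nat.factorial_succ]
    push_cast
    have h1 : (Nat.factorial n : ℝ) ≠ 0 := by positivity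
    have h2 : (Nat.factorial m : ℝ) ≠ 0 := by positivity
    have h3 : (Nat.factorial (m + n) : ℝ) ≠ 0 := by positivity
    field_simp
    ring

lemma integral_sin_pow_odd_mul_cos_pow_even (m n : ℕ) :
    ∫ t in (0 : ℝ)..π / 2, sin t * sin t ^ (2 * m) * cos t ^ (2 * n) =
      4 ^ m * (Nat.factorial m : ℝ) * (Nat.factorial (2 * n) : ℝ) * (Nat.factorial (m + n) : ℝ) /
        ((Nat.factorial n : ℝ) * (Nat.factorial (2 * (m + n) + 1) : ℝ)) := by
  induction m generalizing n with
  | zero =>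
    have h := integral_sin_pow_odd_mul_cos_pow (a := 0) (b := π / 2) 0 (2 * n)
    simp only [Nat.mul_zero, Nat.zero_add, pow_one, cos_pi_div_two, cos_zero, pow_zero, mul_one,
      integral_pow] at h ⊢
    rw [h, Nat.factorial_succ]
    push_cast
    have h1 : (Nat.factorial n : ℝ) ≠ 0 := by positivity
    have h2 : (Nat.factorial (2 * n) : ℝ) ≠ 0 := by positivity
    simp
    field_simp
  | succ m ih =>
    rw [integral_mul_sin_pow_succ_mul_cos_pow continuous_sin, ih, ih,
      show m + 1 + n = m + n + 1 by ring, show m + (n + 1) = m + n + 1 by ring,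
      show 2 * (m + n + 1) + 1 = 2 * (m + n) + 1 + 1 + 1 by ring,
      show 2 * (n + 1) = 2 * n + 1 + 1 by ring]
    simp only [Nat.factorial_succ (n := 2 * (m + n) + 1 + 1),
      Nat.factorial_succ (n := 2 * (m + n) + 1), Nat.factorial_succ (n := m + n),
      Nat.factorial_succ (n := m), Nat.factorial_succ (n := n),
      Nat.factorial_succ (n := 2 * n + 1), Nat.factorial_succ (n := 2 * n)]
    push_cast
    have h1 : (Nat.factorial n : ℝ) ≠ 0 := by positivity
    have h3 : (Nat.factorial (2 * (m + n) + 1) : ℝ) ≠ 0 := by positivity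
    field_simp
    ring

/-- The coefficients of `cos` in powers of `z ^ 2` are of exponential type. -/
lemma abs_cos_coeff_le (z : ℝ) (n : ℕ) :
    |(-1 : ℝ) ^ n * z ^ (2 * n) / (Nat.factorial (2 * n) : ℝ)| ≤
      (z ^ 2) ^ n / (Nat.factorial n : ℝ) := by
  rw [abs_div, abs_mul, abs_pow, abs_neg, abs_one, one_pow, one_mul, Nat.abs_cast, pow_mul,
    abs_of_nonneg (by positivity : (0 : ℝ) ≤ (z ^ 2) ^ n)]
  gcongr
  omega

/-- The coefficients of `J0` in powers of `z ^ 2` are of exponential type. -/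
lemma abs_J0_coeff_le (z : ℝ) (n : ℕ) :
    |(-1 : ℝ) ^ n * z ^ (2 * n) / (2 ^ (2 * n) * (Nat.factorial n : ℝ) ^ 2)| ≤
      (z ^ 2) ^ n / (Nat.factorial n : ℝ) := by
  rw [abs_div, abs_mul, abs_pow, abs_neg, abs_one, one_pow, one_mul, pow_mul,
    abs_of_nonneg (by positivity : (0 : ℝ) ≤ (z ^ 2) ^ n),
    abs_of_nonneg (by positivity : (0 : ℝ) ≤ 2 ^ (2 * n) * (Nat.factorial n : ℝ) ^ 2)]
  gcongr
  have h1 : (1 : ℝ) ≤ Nat.factorial n := by exact_mod_cast Nat.factorial_pos n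
  have h2 : (1 : ℝ) ≤ 2 ^ (2 * n) := one_le_pow₀ (by norm_num)
  nlinarith

lemma integral_cos_sin_mul_cos_cos (p q : ℝ) :
    ∫ t in (0 : ℝ)..π / 2, cos (p * sin t) * cos (q * cos t) = π / 2 * J0 (√(q ^ 2 + p ^ 2)) := by
  have h := hasSum_integral_mul_tsum_sin_sq_mul_tsum_cos_sq (w := fun _ => 1) continuous_const
    (by simp) (abs_cos_coeff_le p) (abs_cos_coeff_le q) 0 (π / 2)
  have e : ∀ t, cos (p * sin t) * cos (q * cos t) =
      1 * (∑' n, (-1 : ℝ) ^ n * p ^ (2 * n) / (Nat.factorial (2 * n) : ℝ) * sin t ^ (2 * n)) *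
        ∑' n, (-1 : ℝ) ^ n * q ^ (2 * n) / (Nat.factorial (2 * n) : ℝ) * cos t ^ (2 * n) := by
    intro t
    rw [Real.cos_eq_tsum, Real.cos_eq_tsum, one_mul]
    congr 2 <;> · ext n; rw [mul_pow]; ring
  simp only [e]
  rw [← h.tsum_eq, J0, ← tsum_mul_left]
  congr 1 with N
  rw [pow_mul, pow_mul 2, Real.sq_sqrt (by positivity), add_comm (q ^ 2)]
  trans π / 2 * ((-1) ^ N / (4 ^ N * (Nat.factorial N : ℝ)) *
    ((p ^ 2 + q ^ 2) ^ N / (Nat.factorial N : ℝ)))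
  · rw [← sum_antidiagonal_pow_div_factorial, Finset.mul_sum, Finset.mul_sum]
    refine Finset.sum_congr rfl fun r hr => ?_
    obtain rfl := Finset.HasAntidiagonal.mem_antidiagonal.mp hr
    rw [integral_sin_pow_even_mul_cos_pow_even_zero_pi_div_two]
    have h1 : (Nat.factorial (2 * r.1) : ℝ) ≠ 0 := by positivity
    have h2 : (Nat.factorial (2 * r.2) : ℝ) ≠ 0 := by positivity
    field_simp
    ring
  · norm_num
    field_simp

lemma integral_sin_mul_J0_sin_mul_cos_cos (p q : ℝ) (hpq : 0 < q ^ 2 + p ^ 2) :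
    ∫ t in (0 : ℝ)..π / 2, sin t * J0 (p * sin t) * cos (q * cos t) =
      sin (√(q ^ 2 + p ^ 2)) / √(q ^ 2 + p ^ 2) := by
  have h := hasSum_integral_mul_tsum_sin_sq_mul_tsum_cos_sq continuous_sin
    abs_sin_le_one (abs_J0_coeff_le p) (abs_cos_coeff_le q) 0 (π / 2)
  have e : ∀ t, sin t * J0 (p * sin t) * cos (q * cos t) =
      sin t * (∑' n, (-1 : ℝ) ^ n * p ^ (2 * n) / (2 ^ (2 * n) * (Nat.factorial n : ℝ) ^ 2) *
          sin t ^ (2 * n)) *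
        ∑' n, (-1 : ℝ) ^ n * q ^ (2 * n) / (Nat.factorial (2 * n) : ℝ) * cos t ^ (2 * n) := by
    intro t
    rw [Real.cos_eq_tsum, J0]
    congr 3 <;> · ext n; rw [mul_pow]; ring
  simp only [e]
  have hs : √(q ^ 2 + p ^ 2) ≠ 0 := (Real.sqrt_pos.mpr hpq).ne'
  rw [← h.tsum_eq, Real.sin_eq_tsum, ← tsum_div_const]
  congr 1 with N
  rw [pow_succ, pow_mul, Real.sq_sqrt hpq.le, add_comm (q ^ 2)]
  rw [add_comm (q ^ 2)] at hs
  trans ((-1) ^ N * (Nat.factorial N : ℝ) / (Nat.factorial (2 * N + 1) : ℝ)) *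
    ((p ^ 2 + q ^ 2) ^ N / (Nat.factorial N : ℝ))
  · rw [← sum_antidiagonal_pow_div_factorial, Finset.mul_sum]
    refine Finset.sum_congr rfl fun r hr => ?_
    obtain rfl := Finset.HasAntidiagonal.mem_antidiagonal.mp hr
    rw [integral_sin_pow_odd_mul_cos_pow_even, show (4 : ℝ) ^ r.1 = 2 ^ (2 * r.1) by
      rw [pow_mul]; norm_num]
    have h1 : (Nat.factorial (2 * r.2) : ℝ) ≠ 0 := by positivity
    field_simp
    ring
  · field_simp

/-- The substitution `r = R * sin t`. -/
lemma integral_div_sqrt_sq_sub_sq {R : ℝ} (hR : 0 < R) (h : ℝ → ℝ → ℝ) :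
    ∫ r in (0 : ℝ)..R, h r (√(R ^ 2 - r ^ 2)) / √(R ^ 2 - r ^ 2) =
      ∫ t in (0 : ℝ)..π / 2, h (R * sin t) (R * cos t) := by
  have himg : (fun t => R * sin t) '' Set.Ioo 0 (π / 2) = Set.Ioo 0 R := by
    ext y
    constructor
    · rintro ⟨t, ⟨ht0, ht1⟩, rfl⟩
      have h0 : 0 < sin t := sin_pos_of_pos_of_lt_pi ht0 (by linarith [pi_pos])
      have h1 : sin t < 1 := by
        rw [← sin_pi_div_two]
        exact sin_lt_sin_of_lt_of_le_pi_div_two (by linarith) le_rfl ht1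
      exact ⟨by positivity, by simpa using mul_lt_mul_of_pos_left h1 hR⟩
    · rintro ⟨hy0, hy1⟩
      have h1 : y / R < 1 := (div_lt_one hR).mpr hy1
      have h0 : 0 < y / R := by positivity
      refine ⟨arcsin (y / R), ⟨arcsin_pos.mpr h0, arcsin_lt_pi_div_two.mpr h1⟩, ?_⟩
      simp only
      rw [sin_arcsin (by linarith) h1.le]
      field_simp
  have hinj : Set.InjOn (fun t => R * sin t) (Set.Ioo 0 (π / 2)) := by
    intro a ha b hb hab
    exact injOn_sin ⟨by linarith [ha.1, pi_pos], ha.2.le⟩ ⟨by linarith [hb.1, pi_pos], hb.2.le⟩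
      (mul_left_cancel₀ hR.ne' hab)
  rw [intervalIntegral.integral_of_le hR.le, intervalIntegral.integral_of_le (by positivity),
    integral_Ioc_eq_integral_Ioo, integral_Ioc_eq_integral_Ioo, ← himg,
    integral_image_eq_integral_abs_deriv_smul (f' := fun t => R * cos t) measurableSet_Ioo
      (fun t _ => ((hasDerivAt_sin t).const_mul R).hasDerivWithinAt) hinj]
  refine setIntegral_congr_fun measurableSet_Ioo fun t ht => ?_
  have hc : 0 < R * cos t :=
    mul_pos hR (cos_pos_of_mem_Ioo ⟨by linarith [ht.1, pi_pos], ht.2⟩)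
  have hsq : √(R ^ 2 - (R * sin t) ^ 2) = R * cos t := by
    rw [show R ^ 2 - (R * sin t) ^ 2 = (R * cos t) ^ 2 by rw [mul_pow, mul_pow, cos_sq']; ring,
      Real.sqrt_sq hc.le]
  simp only [hsq, smul_eq_mul, abs_of_pos hc]
  exact mul_div_cancel₀ _ hc.ne'

lemma mul_sqrt_add_sq {R : ℝ} (hR : 0 ≤ R) (a b : ℝ) :
    R * √(a ^ 2 + b ^ 2) = √((a * R) ^ 2 + (b * R) ^ 2) := by
  rw [show (a * R) ^ 2 + (b * R) ^ 2 = R ^ 2 * (a ^ 2 + b ^ 2) by ring,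
    Real.sqrt_mul (sq_nonneg R), Real.sqrt_sq hR]

lemma integral_cos_mul_cos_sqrt_div_sqrt {L : ℝ} (hL : 0 < L) (a ξ : ℝ) :
    ∫ x in (0 : ℝ)..L, cos (x * ξ) * cos (a * √(L ^ 2 - x ^ 2)) / √(L ^ 2 - x ^ 2) =
      π / 2 * J0 (L * √(a ^ 2 + ξ ^ 2)) := by
  rw [integral_div_sqrt_sq_sub_sq hL (fun x s => cos (x * ξ) * cos (a * s)),
    mul_sqrt_add_sq hL.le, ← integral_cos_sin_mul_cos_cos]
  congr 1 with t
  ring_nf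

lemma integral_mul_J0_mul_cos_sqrt_div_sqrt {R : ℝ} (hR : 0 < R) (b ρ : ℝ)
    (hpos : 0 < b ^ 2 + ρ ^ 2) :
    ∫ r in (0 : ℝ)..R, r * J0 (r * ρ) * cos (b * √(R ^ 2 - r ^ 2)) / √(R ^ 2 - r ^ 2) =
      sin (R * √(b ^ 2 + ρ ^ 2)) / √(b ^ 2 + ρ ^ 2) := by
  have hpos' : 0 < (b * R) ^ 2 + (ρ * R) ^ 2 := by
    rw [show (b * R) ^ 2 + (ρ * R) ^ 2 = R ^ 2 * (b ^ 2 + ρ ^ 2) by ring]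
    positivity
  have h := integral_sin_mul_J0_sin_mul_cos_cos _ _ hpos'
  rw [← mul_sqrt_add_sq hR.le] at h
  have hs : √(b ^ 2 + ρ ^ 2) ≠ 0 := (Real.sqrt_pos.mpr hpos).ne'
  rw [integral_div_sqrt_sq_sub_sq hR (fun r s => r * J0 (r * ρ) * cos (b * s))]
  trans R * (sin (R * √(b ^ 2 + ρ ^ 2)) / (R * √(b ^ 2 + ρ ^ 2)))
  · rw [← h, ← intervalIntegral.integral_const_mul]
    congr 1 with t
    ring_nf
  · field_simp

/-- **Combined Fourier–Hankel transform of the orthogonal function `i_even^{k,l}`.**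
For `R, L > 0`, `k, l ∈ ℕ₀`, `ξ ∈ ℝ`, `ρ ≥ 0` with `(lπ/R)² + ρ² > 0`:
`√(2/π) ∫_0^L ∫_0^R cos(xξ)·r·J₀(rρ)·cos(kπ√(L²-x²)/L)·cos(lπ√(R²-r²)/R)
  /(√(L²-x²)·√(R²-r²)) dr dx
  = √(π/2)·J₀(L√((kπ/L)²+ξ²))·sin(R√((lπ/R)²+ρ²))/√((lπ/R)²+ρ²)`. -/
theorem stmt17 (R L : ℝ) (hR : 0 < R) (hL : 0 < L) (k l : ℕ) (ξ ρ : ℝ)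
    (hρ : 0 ≤ ρ) (hpos : 0 < (l * π / R) ^ 2 + ρ ^ 2) :
    Real.sqrt (2 / π) *
        ∫ x in (0 : ℝ)..L, ∫ r in (0 : ℝ)..R,
          Real.cos (x * ξ) * r * J0 (r * ρ) *
            Real.cos ((k * π / L) * Real.sqrt (L ^ 2 - x ^ 2)) *
            Real.cos ((l * π / R) * Real.sqrt (R ^ 2 - r ^ 2)) /
            (Real.sqrt (L ^ 2 - x ^ 2) * Real.sqrt (R ^ 2 - r ^ 2)) =
      Real.sqrt (π / 2) * J0 (L * Real.sqrt ((k * π / L) ^ 2 + ξ ^ 2)) *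
        Real.sin (R * Real.sqrt ((l * π / R) ^ 2 + ρ ^ 2)) /
        Real.sqrt ((l * π / R) ^ 2 + ρ ^ 2) := by
  have hx := integral_cos_mul_cos_sqrt_div_sqrt hL (k * π / L) ξ
  have hr := integral_mul_J0_mul_cos_sqrt_div_sqrt hR (l * π / R) ρ hpos
  have hsplit : ∀ x r : ℝ, cos (x * ξ) * r * J0 (r * ρ) * cos ((k * π / L) * √(L ^ 2 - x ^ 2)) *
      cos ((l * π / R) * √(R ^ 2 - r ^ 2)) / (√(L ^ 2 - x ^ 2) * √(R ^ 2 - r ^ 2)) =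
      cos (x * ξ) * cos ((k * π / L) * √(L ^ 2 - x ^ 2)) / √(L ^ 2 - x ^ 2) *
        (r * J0 (r * ρ) * cos ((l * π / R) * √(R ^ 2 - r ^ 2)) / √(R ^ 2 - r ^ 2)) := by
    intro x r
    rw [div_mul_div_comm]
    ring
  simp only [hsplit, intervalIntegral.integral_const_mul, intervalIntegral.integral_mul_const]
  rw [hx, hr]
  have hc : √(2 / π) * (π / 2) = √(π / 2) := by
    have h : √(π / 2) * √(π / 2) = π / 2 := Real.mul_self_sqrt (by positivity)
    rw [← inv_div π 2, Real.sqrt_inv]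
    nth_rewrite 2 [← h]
    have : √(π / 2) ≠ 0 := by positivity
    field_simp
  rw [← hc]
  ring
end
end

section
/- Let n ≥ 1, let f be a Schwartz function on ℝⁿ×ℝ, and for b ∈ ℝ define f^e_b(x,y) := (1/2)·(f(x, y+b) + f(x, −y+b)). Then for all b ∈ ℝ, x ∈ ℝⁿ, and η ∈ ℝ: sin(bη) · ∫_ℝ e^{−iyη} f(x,y) dy = (1/i) · ∫_ℝ e^{−iyη} [ f^e_b(x,y) − f^e_0(x, y−b) ] dy. (That is, sin(bη)·f^{I,F}(x,η) = (1/i)·[f^e_b − τ_{(0,−b)} f^e_0]^{I,F}(x,η), where the superscript I,F denotes the partial Fourier transform in the last variable; so the odd information sin(bη)·f^{I,F} is recoverable from the two symmetrized data sets f^e_0 and f^e_b.) -/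
open MeasureTheory Metric Real Filter

noncomputable section

/-- The restriction of a Schwartz function on `E × ℝ` to a line `{x} × ℝ` is integrable. -/
theorem SchwartzMap.integrable_prodMk {E : Type*} [NormedAddCommGroup E] [NormedSpace ℝ E]
    (f : SchwartzMap (E × ℝ) ℂ) (x : E) : Integrable fun y : ℝ => f (x, y) := by
  have hg : (fun y : ℝ => (x, y)).HasTemperateGrowth := by
    have h : (fun y : ℝ => (x, y)) = fun y => (x, (0 : ℝ)) + ContinuousLinearMap.inr ℝ E ℝ y := by
      ext y <;> simp
    rw [h]
    fun_prop
  have ha : AntilipschitzWith 1 fun y : ℝ => (x, y) :=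
    (Isometry.of_dist_eq fun y z => by simp [Prod.dist_eq]).antilipschitz
  exact (SchwartzMap.compCLMOfAntilipschitz ℂ hg ha f).integrable

theorem integral_exp_mul_comp_add (g : ℝ → ℂ) (η c : ℝ) :
    ∫ y : ℝ, Complex.exp (-Complex.I * ((y * η : ℝ) : ℂ)) * g (y + c) =
      Complex.exp (((c * η : ℝ) : ℂ) * Complex.I) *
        ∫ y : ℝ, Complex.exp (-Complex.I * ((y * η : ℝ) : ℂ)) * g y := by
  rw [← integral_add_right_eq_self
    (fun y : ℝ => Complex.exp (-Complex.I * ((y * η : ℝ) : ℂ)) * g y) c, ← integral_const_mul]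
  congr 1 with y
  rw [← mul_assoc, ← Complex.exp_add]
  congr 2
  push_cast
  ring

theorem MeasureTheory.Integrable.exp_mul {g : ℝ → ℂ} (hg : Integrable g) (η : ℝ) :
    Integrable fun y : ℝ => Complex.exp (-Complex.I * ((y * η : ℝ) : ℂ)) * g y := by
  refine hg.bdd_mul (c := 1) (by fun_prop) (.of_forall fun y => ?_)
  simp [Complex.norm_exp]

/-- **The key identity behind the left–right disambiguation.**
For `f` Schwartz on ℝⁿ×ℝ, `f^e_b(x,y) = (1/2)(f(x,y+b)+f(x,-y+b))`, and for all
`b`, `x`, `η`: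
`sin(bη)·∫ e^{-iyη} f(x,y) dy = (1/i)·∫ e^{-iyη} [f^e_b(x,y) - f^e_0(x,y-b)] dy`. -/
theorem stmt18 (n : ℕ) (hn : 1 ≤ n)
    (f : SchwartzMap (EuclideanSpace ℝ (Fin n) × ℝ) ℂ)
    (b : ℝ) (x : EuclideanSpace ℝ (Fin n)) (η : ℝ) :
    ((Real.sin (b * η) : ℝ) : ℂ) *
        ∫ y : ℝ, Complex.exp (-Complex.I * ((y * η : ℝ) : ℂ)) * f (x, y) =
      (1 / Complex.I) *
        ∫ y : ℝ, Complex.exp (-Complex.I * ((y * η : ℝ) : ℂ)) *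
          ((1 / 2 : ℂ) * (f (x, y + b) + f (x, -y + b)) -
            (1 / 2 : ℂ) * (f (x, y - b) + f (x, -(y - b)))) := by
  have hf := f.integrable_prodMk x
  have hsplit : ∀ y : ℝ, Complex.exp (-Complex.I * ((y * η : ℝ) : ℂ)) *
      ((1 / 2 : ℂ) * (f (x, y + b) + f (x, -y + b)) -
        (1 / 2 : ℂ) * (f (x, y - b) + f (x, -(y - b)))) =
      (1 / 2 : ℂ) * (Complex.exp (-Complex.I * ((y * η : ℝ) : ℂ)) * f (x, y + b) -
        Complex.exp (-Complex.I * ((y * η : ℝ) : ℂ)) * f (x, y + -b)) := by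
    intro y
    rw [show -(y - b) = -y + b by ring, ← sub_eq_add_neg y b]
    ring
  simp_rw [hsplit]
  rw [integral_const_mul, integral_sub ((hf.comp_add_right b).exp_mul η)
    ((hf.comp_add_right (-b)).exp_mul η), integral_exp_mul_comp_add (fun y => f (x, y)),
    integral_exp_mul_comp_add (fun y => f (x, y)), Complex.ofReal_sin, Complex.sin,
    neg_mul b η, Complex.ofReal_neg, one_div Complex.I, Complex.inv_I]
  ring
end
end
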